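/- Let S_1,…,S_n ⊆ ℝ be finite nonempty sets and let A = S_1 × ⋯ × S_n ⊆ ℝ^n. Then E(A,…,A) = π^n · vol(ℙ^n)^{−1} · E(S_1)·E(S_2)⋯E(S_n), where vol(ℙ^n) = π^{(n+1)/2}/Γ((n+1)/2), so equivalently E(A,…,A) = Γ((n+1)/2) · π^{(n−1)/2} · E(S_1)⋯E(S_n). -/

import Mathlib

open MeasureTheory ProbabilityTheory Pointwise
open scoped ENNReal RealInnerProductSpace

noncomputable section

/-- `F_{A,c}(w) = ∑_{a ∈ A} c(a) · exp⟨a,w⟩`. -/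
def Fexp {n : ℕ} (A : Finset (EuclideanSpace ℝ (Fin n))) (c : A → ℝ)
    (w : EuclideanSpace ℝ (Fin n)) : ℝ :=
  ∑ a : A, c a * Real.exp ⟪(a : EuclideanSpace ℝ (Fin n)), w⟫

/-- The fewnomial system `(F_{A_1,c_1},…,F_{A_n,c_n})` as a map `ℝ^n → ℝ^n`. -/
def sysF {n : ℕ} (A : Fin n → Finset (EuclideanSpace ℝ (Fin n)))
    (c : ∀ i, A i → ℝ) (w : EuclideanSpace ℝ (Fin n)) : Fin n → ℝ :=
  fun i => Fexp (A i) (c i) w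

/-- The set of nondegenerate common zeros of the system: the Jacobian
(i.e. the derivative) at the zero is invertible. -/
def nondegZeros {n : ℕ} (A : Fin n → Finset (EuclideanSpace ℝ (Fin n)))
    (c : ∀ i, A i → ℝ) : Set (EuclideanSpace ℝ (Fin n)) :=
  {w | sysF A c w = 0 ∧ Function.Bijective (fderiv ℝ (sysF A c) w)}

/-- Independent standard Gaussian coefficients `c_i(a)`, `i = 1,…,n`, `a ∈ A_i`. -/
def coeffMeasure {n : ℕ} (A : Fin n → Finset (EuclideanSpace ℝ (Fin n))) :
    Measure (∀ i, A i → ℝ) :=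
  Measure.pi fun _ => Measure.pi fun _ => gaussianReal 0 1

/-- `E(A_1,…,A_n)`: the expected number of nondegenerate common zeros. -/
def EE {n : ℕ} (A : Fin n → Finset (EuclideanSpace ℝ (Fin n))) : ℝ≥0∞ :=
  ∫⁻ c, ((nondegZeros A c).encard : ℝ≥0∞) ∂(coeffMeasure A)

/-- `E(S)` for finite `S ⊆ ℝ`: the expected number of zeros `w ∈ ℝ` of
`F_{S,c}(w) = ∑_{s∈S} c(s)·e^{sw}` at which the derivative does not vanish,
for independent standard Gaussian coefficients. -/
def E1 (S : Finset ℝ) : ℝ≥0∞ :=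
  ∫⁻ c : S → ℝ,
      (({w : ℝ | (∑ s : S, c s * Real.exp ((s : ℝ) * w)) = 0 ∧
        deriv (fun w => ∑ s : S, c s * Real.exp ((s : ℝ) * w)) w ≠ 0}).encard : ℝ≥0∞)
    ∂(Measure.pi fun _ => gaussianReal 0 1)

/-- The product `S_1 × ⋯ × S_n ⊆ ℝ^n` as a finite subset of Euclidean space. -/
def prodSupport {n : ℕ} (S : Fin n → Finset ℝ) : Finset (EuclideanSpace ℝ (Fin n)) :=
  (Fintype.piFinset S).map
    ⟨fun f => (EuclideanSpace.equiv (Fin n) ℝ).symm f,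
      (EuclideanSpace.equiv (Fin n) ℝ).symm.injective⟩

theorem lintegral_fin_prod_eq_prod {n : ℕ} {E : Fin n → Type*} {mE : ∀ i, MeasurableSpace (E i)}
    {μ : (i : Fin n) → Measure (E i)} [∀ i, SigmaFinite (μ i)] {f : (i : Fin n) → E i → ℝ≥0∞}
    (hf : ∀ i, Measurable (f i)) :
    ∫⁻ x : (i : Fin n) → E i, ∏ i, f i (x i) ∂(Measure.pi μ) = ∏ i, ∫⁻ x, f i x ∂(μ i) := by
  induction n with
  | zero => simp
  | succ n ih =>
    calc
      _ = ∫⁻ x : E 0 × ((i : Fin n) → E (Fin.succ i)),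
            f 0 x.1 * ∏ i : Fin n, f (Fin.succ i) (x.2 i)
            ∂((μ 0).prod (Measure.pi (fun i ↦ μ i.succ))) := by
        refine ((measurePreserving_piFinSuccAbove μ 0).symm.lintegral_comp_emb
          (MeasurableEquiv.measurableEmbedding _) _).symm.trans (lintegral_congr fun x => ?_)
        rw [Fin.prod_univ_succ]
        rfl
      _ = (∫⁻ x, f 0 x ∂μ 0)
            * ∏ i : Fin n, ∫⁻ (x : E (Fin.succ i)), f (Fin.succ i) x ∂(μ i.succ) := by
          rw [← ih fun i => hf _, ← lintegral_prod_mul (hf 0).aemeasurable]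
          exact (Finset.measurable_fun_prod _ fun i _ =>
            (hf _).comp (measurable_pi_apply i)).aemeasurable
      _ = _ := by rw [Fin.prod_univ_succ]

theorem pi_withDensity_eq {n : ℕ} {E : Fin n → Type*} {mE : ∀ i, MeasurableSpace (E i)}
    {μ : (i : Fin n) → Measure (E i)} [∀ i, SigmaFinite (μ i)] {f : (i : Fin n) → E i → ℝ≥0∞}
    (hf : ∀ i, Measurable (f i)) [∀ i, SigmaFinite ((μ i).withDensity (f i))] :
    Measure.pi (fun i => (μ i).withDensity (f i)) =
      (Measure.pi μ).withDensity fun x => ∏ i, f i (x i) := by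
  refine Measure.pi_eq fun s hs => ?_
  have hs' := MeasurableSet.univ_pi hs
  rw [withDensity_apply _ hs', ← lintegral_indicator hs']
  simp_rw [withDensity_apply _ (hs _), ← lintegral_indicator (hs _)]
  rw [← lintegral_fin_prod_eq_prod fun i => (hf i).indicator (hs i)]
  refine lintegral_congr fun x => ?_
  by_cases hx : x ∈ Set.univ.pi s
  · rw [Set.indicator_of_mem hx]
    exact Finset.prod_congr rfl fun i _ => (Set.indicator_of_mem (hx i trivial) _).symm
  · rw [Set.indicator_of_notMem hx]
    obtain ⟨i, hi⟩ : ∃ i, x i ∉ s i := by simpa using hx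
    exact (Finset.prod_eq_zero (Finset.mem_univ i) (Set.indicator_of_notMem hi _)).symm

/-- The product standard Gaussian measure on `ι → ℝ`. -/
abbrev stdGauss (ι : Type*) [Fintype ι] : Measure (ι → ℝ) := Measure.pi fun _ => gaussianReal 0 1

theorem stdGauss_fin_eq_withDensity (n : ℕ) :
    stdGauss (Fin n) = volume.withDensity fun x => ∏ i, gaussianPDF 0 1 (x i) := by
  have h : gaussianReal 0 1 = (volume : Measure ℝ).withDensity (gaussianPDF 0 1) :=
    gaussianReal_of_var_ne_zero 0 one_ne_zero
  have : SigmaFinite ((volume : Measure ℝ).withDensity (gaussianPDF 0 1)) := by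
    rw [← h]; infer_instance
  simp only [stdGauss, h]
  exact pi_withDensity_eq fun _ => measurable_gaussianPDF 0 1

theorem encard_iUnion_eq_tsum {α : Type*} {t : ℕ → Set α}
    (htd : Pairwise (Function.onFun Disjoint t)) :
    ((⋃ k, t k).encard : ℝ≥0∞) = ∑' k, ((t k).encard : ℝ≥0∞) := by
  let _ : MeasurableSpace α := ⊤
  have h : ∀ s : Set α, MeasurableSet s := fun _ => trivial
  simp_rw [← Measure.count_apply (h _)]
  exact measure_iUnion htd fun _ => h _

section AreaFormula

variable {E : Type*} [NormedAddCommGroup E] [NormedSpace ℝ E]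
  {f : E → E} {f' : E → E →L[ℝ] E}

/-- The number of preimages of `y` under `f` at which the derivative `f'` is invertible. -/
def regularFiberCard (f : E → E) (f' : E → E →L[ℝ] E) (y : E) : ℝ≥0∞ :=
  ({x | f x = y ∧ (f' x).det ≠ 0} : Set E).encard

theorem regularFiberCard_eq_tsum {t : ℕ → Set E} (hti : ∀ k, Set.InjOn f (t k))
    (htd : Pairwise (Function.onFun Disjoint t)) (ht : ⋃ k, t k = {x | (f' x).det ≠ 0}) (y : E) :
    regularFiberCard f f' y = ∑' k, (f '' t k).indicator 1 y := by
  have hU : {x | f x = y ∧ (f' x).det ≠ 0} = ⋃ k, {x | f x = y} ∩ t k := by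
    rw [← Set.inter_iUnion, ht]; rfl
  rw [regularFiberCard, hU, encard_iUnion_eq_tsum
    fun i j h => (htd h).mono Set.inter_subset_right Set.inter_subset_right]
  refine tsum_congr fun k => ?_
  by_cases hy : y ∈ f '' t k
  · obtain ⟨x, hx, rfl⟩ := hy
    have : {z | f z = f x} ∩ t k = {x} := by
      ext z
      exact ⟨fun h => hti k h.2 hx h.1, by rintro rfl; exact ⟨rfl, hx⟩⟩
    rw [this, Set.indicator_of_mem (Set.mem_image_of_mem f hx)]
    simp
  · have : {z | f z = y} ∩ t k = ∅ := by
      ext z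
      simpa using fun h hz => hy ⟨z, hz, h⟩
    rw [this, Set.indicator_of_notMem hy]
    simp

variable [MeasurableSpace E] [BorelSpace E]

theorem measurableSet_det_ne_zero (hf'c : Continuous f') : MeasurableSet {x | (f' x).det ≠ 0} :=
  (isOpen_ne_fun (ContinuousLinearMap.continuous_det.comp hf'c) continuous_const).measurableSet

variable [FiniteDimensional ℝ E]

theorem exists_injOn_partition (hf : ∀ x, HasStrictFDerivAt f (f' x) x) (hf'c : Continuous f') :
    ∃ t : ℕ → Set E, (∀ k, MeasurableSet (t k)) ∧ (∀ k, Set.InjOn f (t k)) ∧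
      Pairwise (Function.onFun Disjoint t) ∧ ⋃ k, t k = {x | (f' x).det ≠ 0} := by
  set s : Set E := {x | (f' x).det ≠ 0} with hs
  have hsm : MeasurableSet s := measurableSet_det_ne_zero hf'c
  have hloc : ∀ x, ∃ U : Set E, IsOpen U ∧ (x ∈ s → x ∈ U) ∧ Set.InjOn f U := by
    intro x
    by_cases hx : x ∈ s
    · have h : HasStrictFDerivAt f
          (((f' x).toContinuousLinearEquivOfDetNeZero hx : E ≃L[ℝ] E) : E →L[ℝ] E) x := by
        simpa using hf x
      refine ⟨(h.toOpenPartialHomeomorph f).source, (h.toOpenPartialHomeomorph f).open_source,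
        fun _ => h.mem_toOpenPartialHomeomorph_source, ?_⟩
      simpa using (h.toOpenPartialHomeomorph f).injOn
    · exact ⟨∅, isOpen_empty, fun h => (hx h).elim, Set.injOn_empty f⟩
  choose U hUo hxU hUi using hloc
  obtain ⟨T, -, hTc, hT⟩ := TopologicalSpace.countable_cover_nhdsWithin (f := U) (s := s)
    fun x hx => mem_nhdsWithin_of_mem_nhds ((hUo x).mem_nhds (hxU x hx))
  rcases T.eq_empty_or_nonempty with rfl | hTne
  · refine ⟨fun _ => ∅, by simp, by simp, fun i j _ => by simp [Function.onFun], ?_⟩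
    simpa [Set.subset_empty_iff, eq_comm] using hT
  obtain ⟨e, rfl⟩ := hTc.exists_eq_range hTne
  refine ⟨disjointed fun k => s ∩ U (e k), fun k => MeasurableSet.disjointed
    (fun k => hsm.inter (hUo _).measurableSet) k,
    fun k => (hUi (e k)).mono ((disjointed_subset _ k).trans Set.inter_subset_right),
    disjoint_disjointed _, ?_⟩
  rw [iUnion_disjointed, ← Set.inter_iUnion]
  refine Set.inter_eq_left.2 (hT.trans ?_)
  simp

theorem measurable_regularFiberCard (hf : ∀ x, HasStrictFDerivAt f (f' x) x)
    (hf'c : Continuous f') : Measurable (regularFiberCard f f') := by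
  obtain ⟨t, htm, hti, htd, ht⟩ := exists_injOn_partition hf hf'c
  rw [funext (regularFiberCard_eq_tsum hti htd ht)]
  exact Measurable.tsum fun k => measurable_one.indicator <|
    measurable_image_of_fderivWithin (htm k)
      (fun x _ => (hf x).hasFDerivAt.hasFDerivWithinAt) (hti k)

/-- Area formula with multiplicities. -/
theorem lintegral_regularFiberCard_mul (μ : Measure E) [μ.IsAddHaarMeasure]
    (hf : ∀ x, HasStrictFDerivAt f (f' x) x) (hf'c : Continuous f')
    {g : E → ℝ≥0∞} (hg : Measurable g) :
    ∫⁻ y, regularFiberCard f f' y * g y ∂μ =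
      ∫⁻ x, ENNReal.ofReal |(f' x).det| * g (f x) ∂μ := by
  obtain ⟨t, htm, hti, htd, ht⟩ := exists_injOn_partition hf hf'c
  have hd : ∀ s : Set E, ∀ x ∈ s, HasFDerivWithinAt f (f' x) s x :=
    fun s x _ => (hf x).hasFDerivAt.hasFDerivWithinAt
  have him : ∀ k, MeasurableSet (f '' t k) := fun k =>
    measurable_image_of_fderivWithin (htm k) (hd _) (hti k)
  simp_rw [regularFiberCard_eq_tsum hti htd ht, ← ENNReal.tsum_mul_right]
  rw [lintegral_tsum fun k =>
    ((measurable_one.indicator (him k)).fun_mul hg).aemeasurable]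
  have : ∫⁻ x, ENNReal.ofReal |(f' x).det| * g (f x) ∂μ =
      ∫⁻ x in {x | (f' x).det ≠ 0}, ENNReal.ofReal |(f' x).det| * g (f x) ∂μ := by
    rw [← lintegral_indicator (measurableSet_det_ne_zero hf'c)]
    refine lintegral_congr fun x => ?_
    by_cases hx : (f' x).det = 0 <;> simp [Set.indicator, hx]
  rw [this, ← ht, lintegral_iUnion htm htd]
  refine tsum_congr fun k => ?_
  rw [← lintegral_image_eq_lintegral_abs_det_fderiv_mul μ (htm k) (hd _) (hti k),
    ← lintegral_indicator (him k)]
  refine lintegral_congr fun y => ?_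
  by_cases hy : y ∈ f '' t k <;> simp only [Set.indicator, hy, if_true, if_false] <;> simp

end AreaFormula

section GaussianIntegrals

variable {ι : Type*} [Fintype ι]

theorem integral_cexp_dotProduct_stdGauss (l : ι → ℝ) :
    ∫ c, Complex.exp ((l ⬝ᵥ c : ℝ) * Complex.I) ∂(stdGauss ι) =
      Complex.exp (-(l ⬝ᵥ l : ℝ) / 2) := by
  have h : ∀ c : ι → ℝ, Complex.exp ((l ⬝ᵥ c : ℝ) * Complex.I) =
      ∏ a, Complex.exp ((l a : ℂ) * (c a : ℂ) * Complex.I) := fun c => by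
    rw [← Complex.exp_sum, ← Finset.sum_mul]
    simp [dotProduct]
  simp_rw [h]
  rw [integral_fintype_prod_eq_prod (𝕜 := ℂ)
    (fun a (x : ℝ) => Complex.exp ((l a : ℂ) * (x : ℂ) * Complex.I))]
  simp_rw [← charFun_apply_real, charFun_gaussianReal]
  rw [← Complex.exp_sum]
  congr 1
  simp [dotProduct, Finset.sum_div, neg_div, sq]

theorem integral_cexp_quadratic_gaussianReal (A B : ℝ) {C : ℝ} (hC : 0 ≤ C) :
    ∫ s : ℝ, Complex.exp (-((A + 2 * s * B + s ^ 2 * C : ℝ) : ℂ) / 2) ∂(gaussianReal 0 1) =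
      ((√(1 + C))⁻¹ : ℝ) * Complex.exp (-((A - B ^ 2 / (1 + C) : ℝ) : ℂ) / 2) := by
  have hC' : 0 < 1 + C := by linarith
  rw [integral_gaussianReal_eq_integral_smul one_ne_zero]
  have h : ∀ s : ℝ, gaussianPDFReal 0 1 s •
      Complex.exp (-((A + 2 * s * B + s ^ 2 * C : ℝ) : ℂ) / 2) = ((√(2 * Real.pi))⁻¹ : ℝ) *
        Complex.exp ((-((1 + C) / 2) : ℂ) * (s : ℂ) ^ 2 + (-B : ℂ) * s + (-A / 2 : ℂ)) := by
    intro s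
    rw [gaussianPDFReal, Complex.real_smul, Complex.ofReal_mul, mul_assoc, Complex.ofReal_exp,
      ← Complex.exp_add]
    simp only [NNReal.coe_one, mul_one]
    congr 2
    push_cast
    ring
  simp_rw [h]
  rw [integral_const_mul, integral_cexp_quadratic, ← mul_assoc]
  · congr 1
    · have : (Real.pi / - -((1 + C) / 2) : ℂ) = ((2 * Real.pi / (1 + C) : ℝ) : ℂ) := by
        push_cast
        field_simp
      rw [this, show (1 / 2 : ℂ) = ((1 / 2 : ℝ) : ℂ) by push_cast; rfl,
        ← Complex.ofReal_cpow (by positivity), ← Real.sqrt_eq_rpow, ← Complex.ofReal_mul,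
        Real.sqrt_div (by positivity), div_eq_mul_inv, ← mul_assoc,
        inv_mul_cancel₀ (by positivity), one_mul]
    · congr 1
      push_cast
      field_simp
      ring
  · have : (-((1 + C) / 2) : ℂ) = ((-((1 + C) / 2) : ℝ) : ℂ) := by push_cast; rfl
    rw [this, Complex.ofReal_re]
    linarith

/-- The total mass of `gaussianPDF 0 1 ⟨u, c⟩` under the standard Gaussian, where `U = 1 + |u|²`. -/
def gaussMass (U : ℝ) : ℝ := (√(2 * Real.pi))⁻¹ * (√U)⁻¹

theorem gaussianPDFReal_eq_integral (t : ℝ) :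
    (gaussianPDFReal 0 1 t : ℂ) = ((√(2 * Real.pi))⁻¹ : ℝ) *
      ∫ s : ℝ, Complex.exp ((t : ℂ) * s * Complex.I) ∂(gaussianReal 0 1) := by
  rw [← charFun_apply_real, charFun_gaussianReal, gaussianPDFReal]
  push_cast
  simp [neg_div]

theorem integral_cexp_mul_gaussianPDFReal (l u : ι → ℝ) :
    ∫ c, gaussianPDFReal 0 1 (u ⬝ᵥ c) • Complex.exp ((l ⬝ᵥ c : ℝ) * Complex.I) ∂(stdGauss ι) =
      gaussMass (1 + u ⬝ᵥ u) *
        Complex.exp (-((l ⬝ᵥ l - (l ⬝ᵥ u) ^ 2 / (1 + u ⬝ᵥ u) : ℝ) : ℂ) / 2) := by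
  have h : ∀ c : ι → ℝ, gaussianPDFReal 0 1 (u ⬝ᵥ c) • Complex.exp ((l ⬝ᵥ c : ℝ) * Complex.I) =
      ((√(2 * Real.pi))⁻¹ : ℝ) *
        ∫ s : ℝ, Complex.exp (((l + s • u) ⬝ᵥ c : ℝ) * Complex.I) ∂(gaussianReal 0 1) := by
    intro c
    rw [Complex.real_smul, gaussianPDFReal_eq_integral, mul_assoc, ← integral_mul_const]
    congr 2
    ext s
    rw [← Complex.exp_add, add_dotProduct, smul_dotProduct]
    congr 1
    push_cast
    simp only [smul_eq_mul]
    push_cast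
    ring
  simp_rw [h]
  rw [integral_const_mul, integral_integral_swap]
  · simp_rw [integral_cexp_dotProduct_stdGauss]
    have h2 : ∀ s : ℝ, (l + s • u) ⬝ᵥ (l + s • u) =
        l ⬝ᵥ l + 2 * s * (l ⬝ᵥ u) + s ^ 2 * (u ⬝ᵥ u) := by
      intro s
      simp only [add_dotProduct, dotProduct_add, smul_dotProduct, dotProduct_smul, smul_eq_mul,
        dotProduct_comm u l]
      ring
    simp_rw [h2]
    rw [integral_cexp_quadratic_gaussianReal _ _
      (by simpa [dotProduct] using Finset.sum_nonneg fun i _ => mul_self_nonneg (u i)),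
      ← mul_assoc, ← Complex.ofReal_mul, gaussMass]
  · refine Integrable.of_bound (C := 1) (Continuous.aestronglyMeasurable ?_)
      (Filter.Eventually.of_forall fun x => ?_)
    · simp only [Function.uncurry_def, dotProduct]
      fun_prop
    · exact (Complex.norm_exp_ofReal_mul_I _).le

end GaussianIntegrals

section GaussianMatrices

variable {ι : Type*} [Fintype ι]

theorem gaussMass_nonneg (U : ℝ) : 0 ≤ gaussMass U := by unfold gaussMass; positivity

/-- The standard Gaussian measure weighted by the density of `⟨u, c⟩` at zero coordinate. -/
def weightedGauss (u : ι → ℝ) : Measure (ι → ℝ) :=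
  (stdGauss ι).withDensity fun c => gaussianPDF 0 1 (u ⬝ᵥ c)

theorem measurable_gaussianPDF_dotProduct (u : ι → ℝ) :
    Measurable fun c : ι → ℝ => gaussianPDF 0 1 (u ⬝ᵥ c) := by
  have : Continuous fun c : ι → ℝ => u ⬝ᵥ c := by
    simp only [dotProduct]
    fun_prop
  exact (measurable_gaussianPDF 0 1).comp this.measurable

instance isFiniteMeasure_weightedGauss (u : ι → ℝ) : IsFiniteMeasure (weightedGauss u) := by
  refine isFiniteMeasure_withDensity (ne_of_lt ?_)
  refine (lintegral_mono (g := fun _ => ENNReal.ofReal (√(2 * Real.pi))⁻¹) fun c => ?_).trans_lt ?_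
  · refine ENNReal.ofReal_le_ofReal ?_
    rw [gaussianPDFReal]
    simp only [NNReal.coe_one, mul_one]
    refine mul_le_of_le_one_right (by positivity) (Real.exp_le_one_iff.2 ?_)
    rw [neg_div, neg_nonpos]
    positivity
  · rw [lintegral_const, measure_univ, mul_one]
    exact ENNReal.ofReal_lt_top

theorem measurable_pi_comp {n : ℕ} {E F : Type*} [MeasurableSpace E] [MeasurableSpace F]
    {f : E → F} (hf : Measurable f) :
    Measurable fun (C : Fin n → E) (i : Fin n) => f (C i) :=
  measurable_pi_lambda _ fun i => hf.comp (measurable_pi_apply i)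

theorem integral_weightedGauss (u : ι → ℝ) (g : (ι → ℝ) → ℂ) :
    ∫ c, g c ∂(weightedGauss u) =
      ∫ c, gaussianPDFReal 0 1 (u ⬝ᵥ c) • g c ∂(stdGauss ι) := by
  rw [weightedGauss, integral_withDensity_eq_integral_toReal_smul
    (measurable_gaussianPDF_dotProduct u) (by simp [gaussianPDF])]
  simp [gaussianPDF, ENNReal.toReal_ofReal (gaussianPDFReal_nonneg 0 1 _)]

theorem map_mulVec_weightedGauss {n : ℕ} (u : ι → ℝ) (B : Matrix (Fin n) ι ℝ)
    (R : Matrix (Fin n) (Fin n) ℝ)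
    (hR : ∀ x : Fin n → ℝ, (R.transpose.mulVec x) ⬝ᵥ (R.transpose.mulVec x) =
      (B.transpose.mulVec x) ⬝ᵥ (B.transpose.mulVec x) -
        ((B.transpose.mulVec x) ⬝ᵥ u) ^ 2 / (1 + u ⬝ᵥ u)) :
    (weightedGauss u).map B.mulVec =
      ENNReal.ofReal (gaussMass (1 + u ⬝ᵥ u)) • (stdGauss (Fin n)).map R.mulVec := by
  have hB : Measurable B.mulVec := (B.mulVecLin.continuous_of_finiteDimensional).measurable
  have hRm : Measurable R.mulVec := (R.mulVecLin.continuous_of_finiteDimensional).measurable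
  have : IsFiniteMeasure (ENNReal.ofReal (gaussMass (1 + u ⬝ᵥ u)) •
      (stdGauss (Fin n)).map R.mulVec) := Measure.smul_finite _ ENNReal.ofReal_ne_top
  refine Measure.ext_of_charFunDual ?_
  ext L
  obtain ⟨x, hx⟩ : ∃ x : Fin n → ℝ, ∀ v, L v = x ⬝ᵥ v := by
    refine ⟨fun i => L (Pi.single i 1), fun v => ?_⟩
    have := LinearMap.pi_apply_eq_sum_univ (L : (Fin n → ℝ) →ₗ[ℝ] ℝ) v
    simp only [ContinuousLinearMap.coe_coe, smul_eq_mul] at this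
    rw [this, dotProduct]
    refine Finset.sum_congr rfl fun i _ => ?_
    rw [mul_comm]
    congr 2
    ext j
    simp [Pi.single_apply, eq_comm]
  have hm : ∀ μ : Measure (Fin n → ℝ),
      AEStronglyMeasurable (fun v => Complex.exp (L v * Complex.I)) μ := fun _ =>
    Continuous.aestronglyMeasurable (by fun_prop)
  rw [charFunDual_apply, charFunDual_apply, integral_smul_measure,
    integral_map hB.aemeasurable (hm _), integral_map hRm.aemeasurable (hm _)]
  simp_rw [hx, Matrix.dotProduct_mulVec, ← Matrix.mulVec_transpose]
  rw [integral_weightedGauss, integral_cexp_mul_gaussianPDFReal, integral_cexp_dotProduct_stdGauss,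
    hR, ENNReal.toReal_ofReal (gaussMass_nonneg _), Complex.real_smul]

/-- The expected absolute determinant of a standard Gaussian matrix. -/
def expAbsDet (n : ℕ) : ℝ≥0∞ :=
  ∫⁻ G : Fin n → Fin n → ℝ, ENNReal.ofReal |(Matrix.of G).det|
    ∂(Measure.pi fun _ => stdGauss (Fin n))

theorem measurable_abs_det (n : ℕ) :
    Measurable fun G : Fin n → Fin n → ℝ => ENNReal.ofReal |(Matrix.of G).det| := by
  refine ENNReal.measurable_ofReal.comp (Continuous.measurable ?_)
  exact (Continuous.matrix_det (by exact continuous_id)).abs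

theorem pi_const_smul {n : ℕ} {E : Type*} [MeasurableSpace E] (μ : Measure E) [IsFiniteMeasure μ]
    {k : ℝ≥0∞} (hk : k ≠ ∞) :
    Measure.pi (fun _ : Fin n => k • μ) = k ^ n • Measure.pi fun _ : Fin n => μ := by
  have : IsFiniteMeasure (k • μ) := Measure.smul_finite _ hk
  refine Measure.pi_eq fun s _ => ?_
  simp [Finset.prod_mul_distrib]

theorem lintegral_abs_det_mul_gaussianPDF {n : ℕ} (u : ι → ℝ) (B : Matrix (Fin n) ι ℝ)
    (R : Matrix (Fin n) (Fin n) ℝ)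
    (hR : ∀ x : Fin n → ℝ, (R.transpose.mulVec x) ⬝ᵥ (R.transpose.mulVec x) =
      (B.transpose.mulVec x) ⬝ᵥ (B.transpose.mulVec x) -
        ((B.transpose.mulVec x) ⬝ᵥ u) ^ 2 / (1 + u ⬝ᵥ u)) :
    ∫⁻ C : Fin n → ι → ℝ, ENNReal.ofReal |(Matrix.of fun i => B.mulVec (C i)).det| *
        ∏ i, gaussianPDF 0 1 (u ⬝ᵥ C i) ∂(Measure.pi fun _ => stdGauss ι) =
      ENNReal.ofReal (gaussMass (1 + u ⬝ᵥ u)) ^ n * ENNReal.ofReal |R.det| * expAbsDet n := by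
  have hB : Measurable B.mulVec := (B.mulVecLin.continuous_of_finiteDimensional).measurable
  have hRm : Measurable R.mulVec := (R.mulVecLin.continuous_of_finiteDimensional).measurable
  have hwd : Measure.pi (fun _ : Fin n => weightedGauss u) =
      (Measure.pi fun _ : Fin n => stdGauss ι).withDensity
        fun C => ∏ i, gaussianPDF 0 1 (u ⬝ᵥ C i) := by
    have : SigmaFinite ((stdGauss ι).withDensity fun c => gaussianPDF 0 1 (u ⬝ᵥ c)) :=
      (isFiniteMeasure_weightedGauss u).toSigmaFinite
    exact pi_withDensity_eq fun _ => measurable_gaussianPDF_dotProduct u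
  calc
    _ = ∫⁻ C, ENNReal.ofReal |(Matrix.of fun i => B.mulVec (C i)).det|
          ∂(Measure.pi (fun _ : Fin n => weightedGauss u)) := by
      rw [hwd, lintegral_withDensity_eq_lintegral_mul]
      · simp_rw [Pi.mul_apply, mul_comm]
      · exact Finset.measurable_fun_prod _ fun i _ =>
          (measurable_gaussianPDF_dotProduct u).comp (measurable_pi_apply i)
      · exact (measurable_abs_det n).comp (measurable_pi_comp hB)
    _ = ∫⁻ M : Fin n → Fin n → ℝ, ENNReal.ofReal |(Matrix.of M).det|
          ∂(Measure.pi fun _ : Fin n => (weightedGauss u).map B.mulVec) := by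
      rw [← Measure.pi_map_pi fun _ => hB.aemeasurable,
        lintegral_map (measurable_abs_det n) (measurable_pi_comp hB)]
    _ = ENNReal.ofReal (gaussMass (1 + u ⬝ᵥ u)) ^ n *
          ∫⁻ G : Fin n → Fin n → ℝ, ENNReal.ofReal |(Matrix.of fun i => R.mulVec (G i)).det|
            ∂(Measure.pi fun _ : Fin n => stdGauss (Fin n)) := by
      rw [map_mulVec_weightedGauss u B R hR, pi_const_smul _ ENNReal.ofReal_ne_top,
        lintegral_smul_measure, ← Measure.pi_map_pi fun _ => hRm.aemeasurable,
        lintegral_map (measurable_abs_det n) (measurable_pi_comp hRm), smul_eq_mul]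
    _ = _ := by
      rw [mul_assoc, expAbsDet, ← lintegral_const_mul _ (measurable_abs_det n)]
      congr 1
      refine lintegral_congr fun G => ?_
      rw [← ENNReal.ofReal_mul (abs_nonneg _), ← abs_mul, mul_comm, ← R.det_transpose,
        ← Matrix.det_mul]
      congr 3
      ext i j
      simp [Matrix.mul_apply, Matrix.mulVec, dotProduct, mul_comm]

end GaussianMatrices

section ProjectiveVolume

theorem ae_det_ne_zero (n : ℕ) : ∀ᵐ G : Fin n → Fin n → ℝ, (Matrix.of G).det ≠ 0 := by
  let L : ℝ →ₗ[ℝ] (Fin n → Fin n → ℝ) :=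
    LinearMap.toSpanSingleton ℝ _ (Matrix.of.symm (1 : Matrix (Fin n) (Fin n) ℝ))
  have hs : MeasurableSet {G : Fin n → Fin n → ℝ | (Matrix.of G).det ≠ 0} := by
    refine (isOpen_ne.preimage ?_).measurableSet
    exact Continuous.matrix_det (by exact continuous_id)
  have h := ae_ae_add_linearMap_mem_iff L volume volume hs
  refine h.1 (Filter.Eventually.of_forall fun G => ?_)
  rw [ae_iff]
  refine Set.Finite.measure_zero ?_ _
  refine ((Matrix.of (-G)).charpoly.roots.toFinset.finite_toSet).subset fun t ht => ?_
  simp only [Set.mem_ofPred_eq, not_not] at ht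
  simp only [Finset.mem_coe, Multiset.mem_toFinset,
    Polynomial.mem_roots (Matrix.charpoly_monic _).ne_zero, Polynomial.IsRoot.def,
    Matrix.eval_charpoly]
  rw [← ht]
  congr 1
  ext i j
  simp [L, Matrix.scalar_apply, Matrix.diagonal_apply, Matrix.one_apply, add_comm]

theorem lintegral_abs_det_mul_gaussianPDF_mulVec {n : ℕ} {G : Matrix (Fin n) (Fin n) ℝ}
    (hG : G.det ≠ 0) :
    ∫⁻ x : Fin n → ℝ, ENNReal.ofReal |G.det| * ∏ i, gaussianPDF 0 1 (x ⬝ᵥ G.row i) = 1 := by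
  have hm : Measurable fun y : Fin n → ℝ => ∏ i, gaussianPDF 0 1 (y i) :=
    Finset.measurable_fun_prod _ fun i _ =>
      (measurable_gaussianPDF 0 1).comp (measurable_pi_apply i)
  have hL : Measurable (Matrix.toLin' G) :=
    ((Matrix.toLin' G).continuous_of_finiteDimensional).measurable
  calc
    _ = ENNReal.ofReal |G.det| *
        ∫⁻ y, ∏ i, gaussianPDF 0 1 (y i) ∂(volume.map (Matrix.toLin' G)) := by
      rw [lintegral_map hm hL]
      refine Eq.trans ?_ (lintegral_const_mul _ (hm.comp hL))
      refine lintegral_congr fun x => ?_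
      congr 1
      refine Finset.prod_congr rfl fun i _ => ?_
      rw [dotProduct_comm, Matrix.toLin'_apply]
      rfl
    _ = 1 := by
      rw [Real.map_matrix_volume_pi_eq_smul_volume_pi hG, lintegral_smul_measure, volume_pi,
        lintegral_fin_prod_eq_prod fun _ => measurable_gaussianPDF 0 1, smul_eq_mul, ← mul_assoc,
        ← ENNReal.ofReal_mul (abs_nonneg _), ← abs_mul, mul_inv_cancel₀ hG]
      simp [lintegral_gaussianPDF_eq_one]

theorem lintegral_rpow_mul_exp_neg_mul {s U : ℝ} (hs : 0 < s) (hU : 0 < U) :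
    ∫⁻ t in Set.Ioi (0 : ℝ), ENNReal.ofReal (t ^ (s - 1) * Real.exp (-(U * t))) =
      ENNReal.ofReal ((1 / U) ^ s * Real.Gamma s) := by
  rw [← Real.integral_rpow_mul_exp_neg_mul_Ioi hs hU, ofReal_integral_eq_lintegral_ofReal]
  · have := integrableOn_rpow_mul_exp_neg_mul_rpow (p := 1) (s := s - 1) (b := U)
      (by linarith) one_pos hU
    simpa only [Real.rpow_one, neg_mul, IntegrableOn] using this
  · filter_upwards [ae_restrict_mem measurableSet_Ioi] with t ht
    have : (0 : ℝ) < t := ht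
    positivity

theorem lintegral_exp_neg_mul_sq {b : ℝ} (hb : 0 < b) :
    ∫⁻ x : ℝ, ENNReal.ofReal (Real.exp (-b * x ^ 2)) = ENNReal.ofReal √(Real.pi / b) := by
  rw [← integral_gaussian, ofReal_integral_eq_lintegral_ofReal (integrable_exp_neg_mul_sq hb)]
  exact Filter.Eventually.of_forall fun _ => (Real.exp_pos _).le

theorem lintegral_one_add_sq_rpow (n : ℕ) :
    ∫⁻ x : Fin n → ℝ, ENNReal.ofReal ((1 / (1 + x ⬝ᵥ x)) ^ (((n : ℝ) + 1) / 2)) =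
      ENNReal.ofReal (Real.pi ^ (((n : ℝ) + 1) / 2) / Real.Gamma ((n + 1) / 2)) := by
  have hs : (0 : ℝ) < ((n : ℝ) + 1) / 2 := by positivity
  have hΓ := Real.Gamma_pos_of_pos hs
  have hx : ∀ x : Fin n → ℝ, 0 < 1 + x ⬝ᵥ x := fun x => by
    have : 0 ≤ x ⬝ᵥ x := Finset.sum_nonneg fun i _ => mul_self_nonneg _
    linarith
  have hkey : (∫⁻ x : Fin n → ℝ, ENNReal.ofReal ((1 / (1 + x ⬝ᵥ x)) ^ (((n : ℝ) + 1) / 2))) *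
      ENNReal.ofReal (Real.Gamma ((n + 1) / 2)) =
        ENNReal.ofReal (Real.pi ^ (((n : ℝ) + 1) / 2)) := by
    calc
      _ = ∫⁻ x : Fin n → ℝ, ∫⁻ t in Set.Ioi (0 : ℝ),
          ENNReal.ofReal (t ^ (((n : ℝ) + 1) / 2 - 1) * Real.exp (-((1 + x ⬝ᵥ x) * t))) := by
        rw [← lintegral_mul_const _ (by fun_prop)]
        refine lintegral_congr fun x => ?_
        have := hx x
        rw [lintegral_rpow_mul_exp_neg_mul hs (hx x), ENNReal.ofReal_mul (by positivity)]
      _ = ∫⁻ t in Set.Ioi (0 : ℝ), ∫⁻ x : Fin n → ℝ,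
          ENNReal.ofReal (t ^ (((n : ℝ) + 1) / 2 - 1) * Real.exp (-((1 + x ⬝ᵥ x) * t))) := by
        refine lintegral_lintegral_swap (Measurable.aemeasurable ?_)
        simp only [Function.uncurry_def]
        fun_prop
      _ = ∫⁻ t in Set.Ioi (0 : ℝ), ENNReal.ofReal (√Real.pi ^ n) *
          ENNReal.ofReal (t ^ ((1 / 2 : ℝ) - 1) * Real.exp (-(1 * t))) := by
        refine setLIntegral_congr_fun measurableSet_Ioi fun t ht => ?_
        have ht : 0 < t := ht
        have h1 : ∀ x : Fin n → ℝ,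
            ENNReal.ofReal (t ^ (((n : ℝ) + 1) / 2 - 1) * Real.exp (-((1 + x ⬝ᵥ x) * t))) =
              ENNReal.ofReal (t ^ (((n : ℝ) + 1) / 2 - 1) * Real.exp (-t)) *
                ∏ i, ENNReal.ofReal (Real.exp (-t * x i ^ 2)) := fun x => by
          rw [← ENNReal.ofReal_prod_of_nonneg fun _ _ => (Real.exp_pos _).le,
            ← ENNReal.ofReal_mul (by positivity), mul_assoc, ← Real.exp_sum, ← Real.exp_add]
          congr 3
          rw [← Finset.mul_sum, dotProduct]
          simp only [sq]
          ring
        simp_rw [h1]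
        rw [lintegral_const_mul _ (by fun_prop), volume_pi,
          lintegral_fin_prod_eq_prod
            (f := fun _ y => ENNReal.ofReal (Real.exp (-t * y ^ 2))) fun _ => by fun_prop]
        simp_rw [lintegral_exp_neg_mul_sq ht]
        rw [Finset.prod_const, Finset.card_univ, Fintype.card_fin,
          ← ENNReal.ofReal_pow (by positivity), ← ENNReal.ofReal_mul (by positivity),
          ← ENNReal.ofReal_mul (by positivity)]
        have h2 : t ^ ((1 / 2 : ℝ) - 1) = t ^ (((n : ℝ) + 1) / 2 - 1) / t ^ ((1 / 2 : ℝ) * n) := by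
          rw [← Real.rpow_sub ht]
          ring_nf
        rw [Real.sqrt_div Real.pi_pos.le, div_pow, Real.sqrt_eq_rpow t,
          ← Real.rpow_mul_natCast ht.le, h2, one_mul]
        congr 1
        ring
      _ = ENNReal.ofReal (Real.pi ^ (((n : ℝ) + 1) / 2)) := by
        rw [lintegral_const_mul _ (by fun_prop),
          lintegral_rpow_mul_exp_neg_mul (by norm_num) one_pos, Real.Gamma_one_half_eq,
          ← ENNReal.ofReal_mul (by positivity)]
        congr 1
        rw [Real.sqrt_eq_rpow, ← Real.rpow_mul_natCast Real.pi_pos.le, div_one, Real.one_rpow,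
          one_mul, ← Real.rpow_add Real.pi_pos]
        ring_nf
  rw [ENNReal.ofReal_div_of_pos hΓ, ENNReal.eq_div_iff (by simpa using hΓ) ENNReal.ofReal_ne_top,
    mul_comm, hkey]

theorem expAbsDet_mul_eq (n : ℕ) :
    ENNReal.ofReal ((√(2 * Real.pi))⁻¹) ^ n * expAbsDet n =
      ENNReal.ofReal ((Real.pi ^ (((n : ℝ) + 1) / 2) / Real.Gamma ((n + 1) / 2))⁻¹) := by
  have hΓ := Real.Gamma_pos_of_pos (show (0 : ℝ) < ((n : ℝ) + 1) / 2 by positivity)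
  have hV : 0 < Real.pi ^ (((n : ℝ) + 1) / 2) / Real.Gamma ((n + 1) / 2) := by positivity
  rw [ENNReal.ofReal_inv_of_pos hV]
  refine ENNReal.eq_inv_of_mul_eq_one_left ?_
  rw [← lintegral_one_add_sq_rpow, ← lintegral_const_mul _ (by
    simp only [dotProduct]; fun_prop)]
  have hx : ∀ x : Fin n → ℝ, 0 ≤ x ⬝ᵥ x := fun x =>
    Finset.sum_nonneg fun i _ => mul_self_nonneg _
  have hac : ∀ᵐ G ∂(Measure.pi fun _ : Fin n => stdGauss (Fin n)), (Matrix.of G).det ≠ 0 := by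
    have h : stdGauss (Fin n) = (volume : Measure (Fin n → ℝ)).withDensity
      fun x => ∏ i, gaussianPDF 0 1 (x i) := stdGauss_fin_eq_withDensity n
    have hm : Measurable fun y : Fin n → ℝ => ∏ i, gaussianPDF 0 1 (y i) :=
      Finset.measurable_fun_prod _ fun i _ =>
        (measurable_gaussianPDF 0 1).comp (measurable_pi_apply i)
    have : SigmaFinite ((volume : Measure (Fin n → ℝ)).withDensity
      fun x => ∏ i, gaussianPDF 0 1 (x i)) := by rw [← h]; infer_instance
    rw [h, pi_withDensity_eq fun _ => hm]
    exact (withDensity_absolutelyContinuous _ _).ae_le (ae_det_ne_zero n)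
  calc
    _ = ∫⁻ x : Fin n → ℝ, ∫⁻ G : Fin n → Fin n → ℝ,
          ENNReal.ofReal |(Matrix.of G).det| * ∏ i, gaussianPDF 0 1 (x ⬝ᵥ G i)
            ∂(Measure.pi fun _ => stdGauss (Fin n)) := by
      refine lintegral_congr fun x => ?_
      set r := √(1 + x ⬝ᵥ x) with hr
      have hr0 : 0 < r := Real.sqrt_pos.2 (by linarith [hx x])
      have hr2 : r ^ 2 = 1 + x ⬝ᵥ x := Real.sq_sqrt (by linarith [hx x])
      let R : Matrix (Fin n) (Fin n) ℝ := 1 - (1 / (r * (r + 1))) • Matrix.vecMulVec x x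
      have hRt : ∀ y, R.transpose.mulVec y = y - ((x ⬝ᵥ y) / (r * (r + 1))) • x := fun y => by
        simp only [R, Matrix.transpose_sub, Matrix.transpose_one, Matrix.transpose_smul,
          Matrix.transpose_vecMulVec, Matrix.sub_mulVec, Matrix.one_mulVec, Matrix.smul_mulVec,
          Matrix.vecMulVec_mulVec]
        ext i
        simp only [Pi.sub_apply, Pi.smul_apply, smul_eq_mul, MulOpposite.smul_eq_mul_unop,
          MulOpposite.unop_op]
        ring
      have hdet : R.det = r⁻¹ := by
        have hR : R = 1 + Matrix.replicateCol Unit (-(1 / (r * (r + 1))) • x) *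
            Matrix.replicateRow Unit x := by
          ext i j
          simp [R, Matrix.mul_apply, Matrix.vecMulVec_apply]
          ring
        rw [hR, Matrix.det_one_add_replicateCol_mul_replicateRow, dotProduct_smul, smul_eq_mul,
          show x ⬝ᵥ x = r ^ 2 - 1 by linarith]
        field_simp
        ring
      have := lintegral_abs_det_mul_gaussianPDF x (1 : Matrix (Fin n) (Fin n) ℝ) R fun y => by
        rw [hRt, Matrix.transpose_one, Matrix.one_mulVec, ← hr2]
        simp only [sub_dotProduct, dotProduct_sub, smul_dotProduct, dotProduct_smul, smul_eq_mul]
        rw [dotProduct_comm y x, show x ⬝ᵥ x = r ^ 2 - 1 by linarith]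
        field_simp
        ring
      simp only [Matrix.one_mulVec] at this
      rw [this, hdet, gaussMass, ← hr, ENNReal.ofReal_mul (by positivity), mul_pow,
        abs_of_pos (by positivity), ← hr2]
      have : (1 / r ^ 2) ^ (((n : ℝ) + 1) / 2) = r⁻¹ ^ n * r⁻¹ := by
        rw [one_div, ← inv_pow, ← Real.rpow_natCast_mul (by positivity), ← pow_succ,
          ← Real.rpow_natCast]
        congr 1
        push_cast
        ring
      rw [this, ENNReal.ofReal_mul (by positivity), ENNReal.ofReal_pow (by positivity)]
      ring
    _ = ∫⁻ G : Fin n → Fin n → ℝ, (∫⁻ x : Fin n → ℝ,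
          ENNReal.ofReal |(Matrix.of G).det| * ∏ i, gaussianPDF 0 1 (x ⬝ᵥ G i))
            ∂(Measure.pi fun _ => stdGauss (Fin n)) := by
      refine lintegral_lintegral_swap (Measurable.aemeasurable ?_)
      simp only [Function.uncurry_def]
      refine ((measurable_abs_det n).comp measurable_snd).mul
        (Finset.measurable_fun_prod _ fun i _ => (measurable_gaussianPDF 0 1).comp ?_)
      simp only [dotProduct]
      fun_prop
    _ = ∫⁻ G : Fin n → Fin n → ℝ, 1 ∂(Measure.pi fun _ => stdGauss (Fin n)) := by
      refine lintegral_congr_ae ?_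
      filter_upwards [hac] with G hG
      exact lintegral_abs_det_mul_gaussianPDF_mulVec hG
    _ = 1 := by rw [lintegral_const, measure_univ, mul_one]

end ProjectiveVolume

section KacRice

/-- The number of nondegenerate common zeros of the exponential system with exponents `α`
and coefficients `c`. -/
def expSysCount {n : ℕ} {κ : Type*} [Fintype κ] (α : κ → Fin n → ℝ) (c : Fin n → κ → ℝ) : ℝ≥0∞ :=
  ({w : Fin n → ℝ | (∀ i, ∑ a, c i a * Real.exp (α a ⬝ᵥ w) = 0) ∧
    (Matrix.of fun i j => ∑ a, c i a * (α a j * Real.exp (α a ⬝ᵥ w))).det ≠ 0}).encard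

theorem measurePreserving_splitCoeff (n m : ℕ) :
    MeasurePreserving
      (fun c : Fin n → Fin (m + 1) → ℝ => ((fun i => c i 0), fun i a => c i (Fin.succ a)))
      (Measure.pi fun _ => stdGauss (Fin (m + 1)))
      ((stdGauss (Fin n)).prod (Measure.pi fun _ => stdGauss (Fin m))) := by
  have h1 := measurePreserving_piFinSuccAbove
    (fun _ : Fin (m + 1) => gaussianReal 0 1) 0
  have h2 := measurePreserving_pi (fun _ : Fin n => stdGauss (Fin (m + 1)))
    (fun _ : Fin n => (gaussianReal 0 1).prod (stdGauss (Fin m))) fun _ => h1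
  exact (measurePreserving_arrowProdEquivProdArrow ℝ (Fin m → ℝ) (Fin n)
    (fun _ => gaussianReal 0 1) (fun _ => stdGauss (Fin m))).comp h2

variable {n m : ℕ} (β : Fin m → Fin n → ℝ)

/-- The vector of exponential monomials, with the sign making `tailMap` solve for the
constant coefficient. -/
def expVec (w : Fin n → ℝ) (a : Fin m) : ℝ := -Real.exp (β a ⬝ᵥ w)

/-- The map whose value at `w` is the constant coefficient for which `w` is a zero. -/
def tailMap (C : Fin n → Fin m → ℝ) (w : Fin n → ℝ) (i : Fin n) : ℝ := expVec β w ⬝ᵥ C i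

/-- The matrix pairing gradients of the exponential monomials with coefficients. -/
def gradMatrix (w : Fin n → ℝ) : Matrix (Fin n) (Fin m) ℝ :=
  Matrix.of fun j a => β a j * expVec β w a

/-- The Jacobian matrix of `tailMap`. -/
def tailJacobian (C : Fin n → Fin m → ℝ) (w : Fin n → ℝ) : Matrix (Fin n) (Fin n) ℝ :=
  Matrix.of fun i => (gradMatrix β w).mulVec (C i)

/-- The derivative of `tailMap`. -/
def tailDeriv (C : Fin n → Fin m → ℝ) (w : Fin n → ℝ) : (Fin n → ℝ) →L[ℝ] (Fin n → ℝ) :=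
  (Matrix.toLin' (tailJacobian β C w)).toContinuousLinearMap

theorem det_tailDeriv (C : Fin n → Fin m → ℝ) (w : Fin n → ℝ) :
    (tailDeriv β C w).det = (tailJacobian β C w).det := by
  rw [tailDeriv, LinearMap.det_toContinuousLinearMap, LinearMap.det_toLin']

theorem contDiff_tailMap :
    ContDiff ℝ 1 fun p : (Fin n → Fin m → ℝ) × (Fin n → ℝ) => tailMap β p.1 p.2 := by
  simp only [contDiff_pi, tailMap, expVec, dotProduct]
  fun_prop

theorem contDiff_tailMap_right (C : Fin n → Fin m → ℝ) : ContDiff ℝ 1 (tailMap β C) :=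
  (contDiff_tailMap β).comp (contDiff_const.prodMk contDiff_id)

theorem hasFDerivAt_tailMap (C : Fin n → Fin m → ℝ) (w : Fin n → ℝ) :
    HasFDerivAt (tailMap β C) (tailDeriv β C w) w := by
  rw [hasFDerivAt_pi']
  intro i
  have hexp : ∀ a, HasFDerivAt (fun w : Fin n → ℝ => β a ⬝ᵥ w)
      (∑ j, β a j • ContinuousLinearMap.proj (R := ℝ) (φ := fun _ : Fin n => ℝ) j) w := fun a => by
    simp only [dotProduct]
    exact HasFDerivAt.fun_sum fun j _ => (hasFDerivAt_apply j w).const_mul (β a j)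
  have h := HasFDerivAt.fun_sum (u := Finset.univ) fun a _ => ((hexp a).exp.neg.mul_const (C i a))
  refine h.congr_fderiv ?_
  ext v
  simp only [tailDeriv, tailJacobian, gradMatrix, expVec, Matrix.mulVec, dotProduct,
    sum_apply, smul_apply, neg_apply,
    ContinuousLinearMap.comp_apply, ContinuousLinearMap.proj_apply, smul_eq_mul,
    LinearMap.coe_toContinuousLinearMap', Matrix.toLin'_apply, Matrix.of_apply, Finset.mul_sum,
    Finset.sum_mul]
  rw [Finset.sum_comm]
  refine Finset.sum_congr rfl fun a _ => ?_
  rw [← Finset.sum_neg_distrib, Finset.mul_sum]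
  exact Finset.sum_congr rfl fun j _ => by ring

theorem fderiv_tailMap (C : Fin n → Fin m → ℝ) (w : Fin n → ℝ) :
    fderiv ℝ (tailMap β C) w = tailDeriv β C w := (hasFDerivAt_tailMap β C w).fderiv

theorem continuous_tailDeriv (C : Fin n → Fin m → ℝ) : Continuous (tailDeriv β C) := by
  rw [← funext (fderiv_tailMap β C)]
  exact (contDiff_tailMap_right β C).continuous_fderiv one_ne_zero

theorem hasStrictFDerivAt_tailMap (C : Fin n → Fin m → ℝ) (w : Fin n → ℝ) :
    HasStrictFDerivAt (tailMap β C) (tailDeriv β C w) w := by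
  rw [← fderiv_tailMap]
  exact (contDiff_tailMap_right β C).contDiffAt.hasStrictFDerivAt one_ne_zero

theorem measurable_tailCount :
    Measurable fun p : (Fin n → ℝ) × (Fin n → Fin m → ℝ) =>
      regularFiberCard (tailMap β p.2) (tailDeriv β p.2) p.1 := by
  let Φ : (Fin n → Fin m → ℝ) × (Fin n → ℝ) → (Fin n → Fin m → ℝ) × (Fin n → ℝ) :=
    fun p => (p.1, tailMap β p.1 p.2)
  have hΦ : ContDiff ℝ 1 Φ := contDiff_fst.prodMk (contDiff_tailMap β)
  have hdet : ∀ C w, (fderiv ℝ Φ (C, w)).det ≠ 0 ↔ (tailDeriv β C w).det ≠ 0 := fun C w => by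
    have hd : HasFDerivAt Φ (fderiv ℝ Φ (C, w)) (C, w) :=
      (hΦ.differentiable one_ne_zero _).hasFDerivAt
    have h1 : ∀ v, (fderiv ℝ Φ (C, w) v).1 = v.1 := fun v => by
      have h3 : HasFDerivAt (fun p => (Φ p).1) _ (C, w) :=
        (hasFDerivAt_fst (𝕜 := ℝ)).comp _ hd
      have h4 : HasFDerivAt (fun p => (Φ p).1) _ (C, w) := hasFDerivAt_fst (𝕜 := ℝ)
      exact DFunLike.congr_fun (h3.unique h4) v
    have h2 : ∀ v, fderiv ℝ Φ (C, w) (0, v) = (0, tailDeriv β C w v) := fun v => by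
      have h3 : HasFDerivAt (fun w => Φ (C, w)) _ w := hd.comp w (hasFDerivAt_prodMk_right C w)
      have h4 : HasFDerivAt (fun w => Φ (C, w)) _ w :=
        (hasFDerivAt_const C w).prodMk (hasFDerivAt_tailMap β C w)
      exact DFunLike.congr_fun (h3.unique h4) v
    simp only [ContinuousLinearMap.det, ne_eq, LinearMap.det_eq_zero_iff_ker_ne_bot, not_not,
      LinearMap.ker_eq_bot']
    refine ⟨fun h v hv => ?_, fun h v hv => ?_⟩
    · have := h (0, v) ((h2 v).trans (congrArg (Prod.mk 0) hv))
      exact congrArg Prod.snd this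
    · obtain ⟨v₁, v₂⟩ := v
      have hv' : fderiv ℝ Φ (C, w) (v₁, v₂) = 0 := hv
      have h5 : v₁ = 0 := (h1 (v₁, v₂)).symm.trans (congrArg Prod.fst hv')
      subst h5
      have h6 := h v₂ (by rw [h2] at hv'; exact congrArg Prod.snd hv')
      rw [h6]
      rfl
  have hmeas : Measurable (regularFiberCard Φ (fderiv ℝ Φ)) :=
    measurable_regularFiberCard (fun p => hΦ.contDiffAt.hasStrictFDerivAt one_ne_zero)
      (hΦ.continuous_fderiv one_ne_zero)
  convert! hmeas.comp measurable_swap using 1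
  ext ⟨y, C⟩
  simp only [Function.comp_apply, Prod.swap_prod_mk, regularFiberCard]
  have : {x | Φ x = (C, y) ∧ (fderiv ℝ Φ x).det ≠ 0} =
      Prod.mk C '' {w | tailMap β C w = y ∧ (tailDeriv β C w).det ≠ 0} := by
    ext ⟨C', w⟩
    simp only [Set.mem_ofPred_eq, Set.mem_image, Prod.mk.injEq, Φ]
    constructor
    · rintro ⟨⟨rfl, h⟩, h'⟩
      exact ⟨w, ⟨h, (hdet _ _).1 h'⟩, rfl, rfl⟩
    · rintro ⟨w, ⟨h, h'⟩, rfl, rfl⟩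
      exact ⟨⟨rfl, h⟩, (hdet _ _).2 h'⟩
  rw [this, (Prod.mk_right_injective C).encard_image]

theorem expSysCount_eq (α : Fin (m + 1) → Fin n → ℝ) (c : Fin n → Fin (m + 1) → ℝ) :
    expSysCount α c =
      regularFiberCard (tailMap (fun a => α (Fin.succ a) - α 0) fun i a => c i (Fin.succ a))
        (tailDeriv (fun a => α (Fin.succ a) - α 0) fun i a => c i (Fin.succ a))
        (fun i => c i 0) := by
  rw [expSysCount, regularFiberCard]
  congr 2
  ext w
  simp only [Set.mem_ofPred_eq, det_tailDeriv]
  have hexp : ∀ a : Fin m, Real.exp (α (Fin.succ a) ⬝ᵥ w) =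
      -(Real.exp (α 0 ⬝ᵥ w) * expVec (fun a => α (Fin.succ a) - α 0) w a) := fun a => by
    rw [expVec, mul_neg, neg_neg, ← Real.exp_add, sub_dotProduct, add_sub_cancel]
  set s := Real.exp (α 0 ⬝ᵥ w) with hs
  have hs0 : s ≠ 0 := (Real.exp_pos _).ne'
  set u := expVec (fun a => α (Fin.succ a) - α 0) w with hu
  have hdot : ∀ i, (u ⬝ᵥ fun a => c i (Fin.succ a)) = ∑ a, u a * c i (Fin.succ a) :=
    fun _ => rfl
  have hzero : (∀ i, ∑ a, c i a * Real.exp (α a ⬝ᵥ w) = 0) ↔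
      tailMap (fun a => α (Fin.succ a) - α 0) (fun i a => c i (Fin.succ a)) w =
        fun i => c i 0 := by
    rw [funext_iff]
    refine forall_congr' fun i => ?_
    have : ∑ a, c i a * Real.exp (α a ⬝ᵥ w) =
        s * (c i 0 - u ⬝ᵥ fun a => c i (Fin.succ a)) := by
      rw [Fin.sum_univ_succ, hdot, mul_sub, Finset.mul_sum, sub_eq_add_neg,
        ← Finset.sum_neg_distrib]
      simp_rw [hexp]
      congr 1
      · ring
      · exact Finset.sum_congr rfl fun a _ => by ring
    rw [this, tailMap, mul_eq_zero, or_iff_right hs0, sub_eq_zero, eq_comm]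
  refine and_congr_right_iff.2 ?_ |>.trans (and_congr_left' hzero)
  intro h
  have hJ : (Matrix.of fun i j => ∑ a, c i a * (α a j * Real.exp (α a ⬝ᵥ w))) =
      (-s) • tailJacobian (fun a => α (Fin.succ a) - α 0) (fun i a => c i (Fin.succ a)) w := by
    ext i j
    have hi := h i
    rw [Fin.sum_univ_succ] at hi
    have hrow : tailJacobian (fun a => α (Fin.succ a) - α 0) (fun i a => c i (Fin.succ a)) w i j =
        ∑ a, (α (Fin.succ a) j - α 0 j) * u a * c i (Fin.succ a) := rfl
    rw [Matrix.smul_apply, smul_eq_mul, hrow, Matrix.of_apply]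
    rw [Fin.sum_univ_succ, show c i 0 * (α 0 j * Real.exp (α 0 ⬝ᵥ w)) =
      α 0 j * (c i 0 * Real.exp (α 0 ⬝ᵥ w)) by ring, eq_neg_of_add_eq_zero_left hi,
      Finset.mul_sum, mul_neg, Finset.mul_sum, ← Finset.sum_neg_distrib,
      ← Finset.sum_add_distrib]
    refine Finset.sum_congr rfl fun a _ => ?_
    rw [hexp]
    ring
  rw [hJ, Matrix.det_smul, mul_ne_zero_iff, and_iff_right (pow_ne_zero _ (neg_ne_zero.2 hs0))]

theorem variance_identity_of_tail {p₀ t U D V Q : ℝ} (hp : p₀ ≠ 0) (hU : U ≠ 0)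
    (h : p₀ * U * (p₀ * (t ^ 2 * U + 2 * t * D + V)) - (p₀ * (t * U + D)) ^ 2 =
      (p₀ * U) ^ 2 * Q) : U * Q = V - D ^ 2 / U := by
  have h' : p₀ ^ 2 * (U * V - D ^ 2) = p₀ ^ 2 * (U ^ 2 * Q) := by linear_combination h
  have h'' := mul_left_cancel₀ (pow_ne_zero 2 hp) h'
  field_simp
  linear_combination -h''

theorem lintegral_expSysCount (α : Fin (m + 1) → Fin n → ℝ) {σ : (Fin n → ℝ) → Fin n → ℝ}
    (hσ0 : ∀ w j, 0 ≤ σ w j)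
    (hσ : ∀ w x, (∑ a, Real.exp (α a ⬝ᵥ w) ^ 2) *
        (∑ a, Real.exp (α a ⬝ᵥ w) ^ 2 * (α a ⬝ᵥ x) ^ 2) -
          (∑ a, Real.exp (α a ⬝ᵥ w) ^ 2 * (α a ⬝ᵥ x)) ^ 2 =
      (∑ a, Real.exp (α a ⬝ᵥ w) ^ 2) ^ 2 * ∑ j, σ w j ^ 2 * x j ^ 2) :
    ∫⁻ c, expSysCount α c ∂(Measure.pi fun _ => stdGauss (Fin (m + 1))) =
      ENNReal.ofReal ((Real.pi ^ (((n : ℝ) + 1) / 2) / Real.Gamma ((n + 1) / 2))⁻¹) *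
        ∫⁻ w, ENNReal.ofReal (∏ j, σ w j) := by
  set β : Fin m → Fin n → ℝ := fun a => α (Fin.succ a) - α 0 with hβ
  have hpdf : Measurable fun y : Fin n → ℝ => ∏ i, gaussianPDF 0 1 (y i) :=
    Finset.measurable_fun_prod _ fun i _ =>
      (measurable_gaussianPDF 0 1).comp (measurable_pi_apply i)
  calc
    _ = ∫⁻ p : (Fin n → ℝ) × (Fin n → Fin m → ℝ),
          regularFiberCard (tailMap β p.2) (tailDeriv β p.2) p.1
            ∂((stdGauss (Fin n)).prod (Measure.pi fun _ => stdGauss (Fin m))) := by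
      rw [← (measurePreserving_splitCoeff n m).lintegral_comp (measurable_tailCount β)]
      exact lintegral_congr fun c => expSysCount_eq α c
    _ = ∫⁻ C : Fin n → Fin m → ℝ, (∫⁻ w : Fin n → ℝ, ENNReal.ofReal |(tailDeriv β C w).det| *
          ∏ i, gaussianPDF 0 1 (tailMap β C w i)) ∂(Measure.pi fun _ => stdGauss (Fin m)) := by
      rw [lintegral_prod_symm _ (measurable_tailCount β).aemeasurable]
      refine lintegral_congr fun C => ?_
      have hf := hasStrictFDerivAt_tailMap β C
      have hc := continuous_tailDeriv β C
      rw [← lintegral_regularFiberCard_mul volume hf hc hpdf, stdGauss_fin_eq_withDensity,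
        lintegral_withDensity_eq_lintegral_mul _ hpdf (measurable_regularFiberCard hf hc)]
      simp only [Pi.mul_apply, mul_comm]
    _ = ∫⁻ w : Fin n → ℝ, ∫⁻ C : Fin n → Fin m → ℝ, ENNReal.ofReal |(tailDeriv β C w).det| *
          ∏ i, gaussianPDF 0 1 (tailMap β C w i) ∂(Measure.pi fun _ => stdGauss (Fin m)) := by
      refine lintegral_lintegral_swap (Measurable.aemeasurable ?_)
      have hd : Continuous fun p : (Fin n → Fin m → ℝ) × (Fin n → ℝ) =>
          (tailJacobian β p.1 p.2).det := by
        refine Continuous.matrix_det (continuous_matrix fun i j => ?_)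
        simp only [tailJacobian, gradMatrix, expVec, Matrix.of_apply, Matrix.mulVec, dotProduct]
        fun_prop
      simp only [Function.uncurry_def, det_tailDeriv]
      exact (ENNReal.measurable_ofReal.comp hd.abs.measurable).mul
        (hpdf.comp (contDiff_tailMap β).continuous.measurable)
    _ = _ := by
      rw [← lintegral_const_mul' _ _ ENNReal.ofReal_ne_top]
      refine lintegral_congr fun w => ?_
      set U := 1 + expVec β w ⬝ᵥ expVec β w with hU
      have hU0 : 0 < U := by
        have : 0 ≤ expVec β w ⬝ᵥ expVec β w := Finset.sum_nonneg fun _ _ => mul_self_nonneg _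
        linarith
      have hR : ∀ x : Fin n → ℝ,
          (Matrix.diagonal fun j => √U * σ w j).transpose.mulVec x ⬝ᵥ
            (Matrix.diagonal fun j => √U * σ w j).transpose.mulVec x =
          ((gradMatrix β w).transpose.mulVec x) ⬝ᵥ ((gradMatrix β w).transpose.mulVec x) -
            (((gradMatrix β w).transpose.mulVec x) ⬝ᵥ expVec β w) ^ 2 / U := fun x => by
        have hB : (gradMatrix β w).transpose.mulVec x = fun a => (β a ⬝ᵥ x) * expVec β w a := by
          ext a
          simp only [gradMatrix, Matrix.mulVec, dotProduct, Matrix.transpose_apply,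
            Matrix.of_apply, Finset.sum_mul]
          exact Finset.sum_congr rfl fun _ _ => by ring
        have hexp : ∀ a : Fin m, Real.exp (α (Fin.succ a) ⬝ᵥ w) ^ 2 =
            Real.exp (α 0 ⬝ᵥ w) ^ 2 * expVec β w a ^ 2 := fun a => by
          rw [expVec, neg_sq, ← mul_pow, ← Real.exp_add, hβ, sub_dotProduct, add_sub_cancel]
        have hα : ∀ a : Fin m, α (Fin.succ a) ⬝ᵥ x = α 0 ⬝ᵥ x + β a ⬝ᵥ x := fun a => by
          rw [hβ, sub_dotProduct, add_sub_cancel]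
        have hL : (Matrix.diagonal fun j => √U * σ w j).transpose.mulVec x ⬝ᵥ
            (Matrix.diagonal fun j => √U * σ w j).transpose.mulVec x =
              U * ∑ j, σ w j ^ 2 * x j ^ 2 := by
          rw [Matrix.diagonal_transpose, dotProduct, Finset.mul_sum]
          refine Finset.sum_congr rfl fun j _ => ?_
          rw [Matrix.mulVec_diagonal]
          linear_combination (σ w j ^ 2 * x j ^ 2) * Real.mul_self_sqrt hU0.le
        rw [hL, hB]
        refine variance_identity_of_tail (p₀ := Real.exp (α 0 ⬝ᵥ w) ^ 2) (t := α 0 ⬝ᵥ x)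
          (by positivity) hU0.ne' ?_
        have h := hσ w x
        have hUU : expVec β w ⬝ᵥ expVec β w = ∑ a, expVec β w a ^ 2 :=
          Finset.sum_congr rfl fun _ _ => by ring
        have hD : ((fun a => (β a ⬝ᵥ x) * expVec β w a) ⬝ᵥ expVec β w) =
            ∑ a, expVec β w a ^ 2 * (β a ⬝ᵥ x) := Finset.sum_congr rfl fun _ _ => by ring
        have hV : ((fun a => (β a ⬝ᵥ x) * expVec β w a) ⬝ᵥ
            fun a => (β a ⬝ᵥ x) * expVec β w a) = ∑ a, expVec β w a ^ 2 * (β a ⬝ᵥ x) ^ 2 :=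
          Finset.sum_congr rfl fun _ _ => by ring
        have h1 : ∑ a, Real.exp (α a ⬝ᵥ w) ^ 2 = Real.exp (α 0 ⬝ᵥ w) ^ 2 * U := by
          rw [Fin.sum_univ_succ, hU, hUU, mul_add, mul_one, Finset.mul_sum]
          simp_rw [hexp]
        have h2 : ∑ a, Real.exp (α a ⬝ᵥ w) ^ 2 * (α a ⬝ᵥ x) = Real.exp (α 0 ⬝ᵥ w) ^ 2 *
            ((α 0 ⬝ᵥ x) * U + (fun a => (β a ⬝ᵥ x) * expVec β w a) ⬝ᵥ expVec β w) := by
          rw [Fin.sum_univ_succ, hU, hUU, hD, mul_add (α 0 ⬝ᵥ x), mul_one, add_assoc, mul_add]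
          simp only [hexp, hα, Finset.mul_sum, ← Finset.sum_add_distrib]
          congr 1
          exact Finset.sum_congr rfl fun a _ => by ring
        have h3 : ∑ a, Real.exp (α a ⬝ᵥ w) ^ 2 * (α a ⬝ᵥ x) ^ 2 = Real.exp (α 0 ⬝ᵥ w) ^ 2 *
            ((α 0 ⬝ᵥ x) ^ 2 * U + 2 * (α 0 ⬝ᵥ x) *
              ((fun a => (β a ⬝ᵥ x) * expVec β w a) ⬝ᵥ expVec β w) +
              (fun a => (β a ⬝ᵥ x) * expVec β w a) ⬝ᵥ fun a => (β a ⬝ᵥ x) * expVec β w a) := by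
          rw [Fin.sum_univ_succ, hU, hUU, hD, hV, mul_add ((α 0 ⬝ᵥ x) ^ 2), mul_one, add_assoc,
            add_assoc, mul_add]
          simp only [hexp, hα, Finset.mul_sum, ← Finset.sum_add_distrib]
          congr 1
          exact Finset.sum_congr rfl fun a _ => by ring
        rw [← h1, ← h2, ← h3, h]
      simp_rw [det_tailDeriv]
      refine (lintegral_abs_det_mul_gaussianPDF (expVec β w) (gradMatrix β w)
        (Matrix.diagonal fun j => √U * σ w j) hR).trans ?_
      rw [← hU, ← expAbsDet_mul_eq, Matrix.det_diagonal, Finset.prod_mul_distrib,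
        Finset.prod_const, Finset.card_univ, Fintype.card_fin, gaussMass,
        abs_of_nonneg (mul_nonneg (by positivity) (Finset.prod_nonneg fun j _ => hσ0 w j)),
        ENNReal.ofReal_mul (by positivity), ENNReal.ofReal_mul (by positivity), mul_pow,
        ENNReal.ofReal_pow (by positivity)]
      have : ENNReal.ofReal (√U)⁻¹ ^ n * ENNReal.ofReal √U ^ n = 1 := by
        rw [← mul_pow, ← ENNReal.ofReal_mul (by positivity),
          inv_mul_cancel₀ (Real.sqrt_pos.2 hU0).ne', ENNReal.ofReal_one, one_pow]
      calc
        _ = (ENNReal.ofReal (√U)⁻¹ ^ n * ENNReal.ofReal √U ^ n) *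
            (ENNReal.ofReal (√(2 * Real.pi))⁻¹ ^ n * expAbsDet n *
              ENNReal.ofReal (∏ j, σ w j)) := by ring
        _ = _ := by rw [this, one_mul]

end KacRice

section ProductVariance

theorem sum_piFinset_prod_mul {n : ℕ} {S : Fin n → Finset ℝ} {p : Fin n → ℝ → ℝ}
    (hp : ∀ j, ∑ s ∈ S j, p j s = 1) (j : Fin n) :
    ∑ a ∈ Fintype.piFinset S, (∏ i, p i (a i)) * a j = ∑ s ∈ S j, p j s * s := by
  have h : ∀ a : Fin n → ℝ, (∏ i, p i (a i)) * a j =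
      ∏ i, p i (a i) * (if i = j then a i else 1) := fun a => by
    rw [Finset.prod_mul_distrib]
    simp
  simp_rw [h]
  rw [← Finset.prod_univ_sum S fun i s => p i s * if i = j then s else 1,
    Finset.prod_eq_single j]
  · simp
  · intro i _ hi
    simp [hi, hp]
  · simp

theorem sum_piFinset_prod_mul_mul {n : ℕ} {S : Fin n → Finset ℝ} {p : Fin n → ℝ → ℝ}
    (hp : ∀ j, ∑ s ∈ S j, p j s = 1) (j k : Fin n) :
    ∑ a ∈ Fintype.piFinset S, (∏ i, p i (a i)) * (a j * a k) =
      (∑ s ∈ S j, p j s * s) * (∑ s ∈ S k, p k s * s) +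
        if j = k then ∑ s ∈ S j, p j s * s ^ 2 - (∑ s ∈ S j, p j s * s) ^ 2 else 0 := by
  have h : ∀ a : Fin n → ℝ, (∏ i, p i (a i)) * (a j * a k) =
      ∏ i, p i (a i) * ((if i = j then a i else 1) * (if i = k then a i else 1)) := fun a => by
    rw [Finset.prod_mul_distrib, Finset.prod_mul_distrib]
    simp
  simp_rw [h]
  rw [← Finset.prod_univ_sum S
    fun i s => p i s * ((if i = j then s else 1) * if i = k then s else 1)]
  rcases eq_or_ne j k with rfl | hjk
  · rw [Finset.prod_eq_single j]
    · simp [sq]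
    · intro i _ hi
      simp [hi, hp]
    · simp
  · have : ∀ i, ∑ s ∈ S i, p i s * ((if i = j then s else 1) * if i = k then s else 1) =
        (if i = j then ∑ s ∈ S i, p i s * s else 1) *
          (if i = k then ∑ s ∈ S i, p i s * s else 1) := fun i => by
      rcases eq_or_ne i j with rfl | hi
      · simp [hjk]
      · simp [hi]
        split_ifs <;> simp [hp]
    simp_rw [this]
    rw [Finset.prod_mul_distrib]
    simp [hjk]

theorem sum_piFinset_prod_mul_dotProduct {n : ℕ} {S : Fin n → Finset ℝ} {p : Fin n → ℝ → ℝ}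
    (hp : ∀ j, ∑ s ∈ S j, p j s = 1) (x : Fin n → ℝ) :
    ∑ a ∈ Fintype.piFinset S, (∏ i, p i (a i)) * (a ⬝ᵥ x) =
      ∑ j, (∑ s ∈ S j, p j s * s) * x j := by
  simp_rw [dotProduct, Finset.mul_sum, ← sum_piFinset_prod_mul hp, Finset.sum_mul]
  rw [Finset.sum_comm]
  simp only [mul_assoc]

theorem sum_piFinset_prod_mul_dotProduct_sq {n : ℕ} {S : Fin n → Finset ℝ} {p : Fin n → ℝ → ℝ}
    (hp : ∀ j, ∑ s ∈ S j, p j s = 1) (x : Fin n → ℝ) :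
    ∑ a ∈ Fintype.piFinset S, (∏ i, p i (a i)) * (a ⬝ᵥ x) ^ 2 =
      (∑ j, (∑ s ∈ S j, p j s * s) * x j) ^ 2 +
        ∑ j, (∑ s ∈ S j, p j s * s ^ 2 - (∑ s ∈ S j, p j s * s) ^ 2) * x j ^ 2 := by
  calc
    _ = ∑ j, ∑ k, (∑ a ∈ Fintype.piFinset S, (∏ i, p i (a i)) * (a j * a k)) * (x j * x k) := by
      simp_rw [dotProduct, sq, Finset.sum_mul_sum, Finset.mul_sum, Finset.sum_mul]
      rw [Finset.sum_comm]
      refine Finset.sum_congr rfl fun j _ => ?_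
      rw [Finset.sum_comm]
      exact Finset.sum_congr rfl fun k _ => Finset.sum_congr rfl fun a _ => by ring
    _ = _ := by
      simp_rw [sum_piFinset_prod_mul_mul hp, add_mul, Finset.sum_add_distrib, ite_mul, zero_mul,
        Finset.sum_ite_eq, Finset.mem_univ, if_true, ← sq]
      congr 1
      rw [sq, Finset.sum_mul_sum]
      exact Finset.sum_congr rfl fun j _ => Finset.sum_congr rfl fun k _ => by ring

end ProductVariance

section ExponentialWeights

/-- The normalized weight of `s` among the squared exponentials `exp (s * t) ^ 2`, `s ∈ S`. -/
def expWeight (S : Finset ℝ) (t s : ℝ) : ℝ :=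
  Real.exp (s * t) ^ 2 / ∑ s ∈ S, Real.exp (s * t) ^ 2

/-- The variance of the probability weights `expWeight S t` on `S`. -/
def expVariance (S : Finset ℝ) (t : ℝ) : ℝ :=
  ∑ s ∈ S, expWeight S t s * s ^ 2 - (∑ s ∈ S, expWeight S t s * s) ^ 2

variable {S : Finset ℝ}

theorem sum_sq_exp_pos (hS : S.Nonempty) (t : ℝ) : 0 < ∑ s ∈ S, Real.exp (s * t) ^ 2 :=
  Finset.sum_pos (fun _ _ => by positivity) hS

theorem sum_expWeight (hS : S.Nonempty) (t : ℝ) : ∑ s ∈ S, expWeight S t s = 1 := by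
  simp_rw [expWeight]
  rw [← Finset.sum_div, div_self (sum_sq_exp_pos hS t).ne']

theorem expWeight_nonneg (S : Finset ℝ) (t s : ℝ) : 0 ≤ expWeight S t s :=
  div_nonneg (by positivity) (Finset.sum_nonneg fun _ _ => by positivity)

theorem expVariance_nonneg (hS : S.Nonempty) (t : ℝ) : 0 ≤ expVariance S t := by
  have h : expVariance S t =
      ∑ s ∈ S, expWeight S t s * (s - ∑ s ∈ S, expWeight S t s * s) ^ 2 := by
    set E := ∑ s ∈ S, expWeight S t s * s with hE
    have : ∀ s, expWeight S t s * (s - E) ^ 2 =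
        expWeight S t s * s ^ 2 - 2 * E * (expWeight S t s * s) + E ^ 2 * expWeight S t s :=
      fun s => by ring
    simp_rw [this]
    rw [Finset.sum_add_distrib, Finset.sum_sub_distrib, ← Finset.mul_sum, ← Finset.mul_sum,
      sum_expWeight hS, ← hE, expVariance, ← hE]
    ring
  rw [h]
  exact Finset.sum_nonneg fun s _ => mul_nonneg (expWeight_nonneg S t s) (sq_nonneg _)

theorem measurable_expVariance (S : Finset ℝ) : Measurable (expVariance S) := by
  unfold expVariance expWeight
  fun_prop

theorem sum_piFinset_exp_variance {n : ℕ} {S : Fin n → Finset ℝ} (hS : ∀ j, (S j).Nonempty)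
    (w x : Fin n → ℝ) :
    (∑ a ∈ Fintype.piFinset S, Real.exp (a ⬝ᵥ w) ^ 2) *
        (∑ a ∈ Fintype.piFinset S, Real.exp (a ⬝ᵥ w) ^ 2 * (a ⬝ᵥ x) ^ 2) -
          (∑ a ∈ Fintype.piFinset S, Real.exp (a ⬝ᵥ w) ^ 2 * (a ⬝ᵥ x)) ^ 2 =
      (∑ a ∈ Fintype.piFinset S, Real.exp (a ⬝ᵥ w) ^ 2) ^ 2 *
        ∑ j, √(expVariance (S j) (w j)) ^ 2 * x j ^ 2 := by
  have hp : ∀ j, ∑ s ∈ S j, expWeight (S j) (w j) s = 1 := fun j => sum_expWeight (hS j) _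
  set Z := ∏ j, ∑ s ∈ S j, Real.exp (s * w j) ^ 2 with hZ
  have hexp : ∀ a : Fin n → ℝ, Real.exp (a ⬝ᵥ w) ^ 2 =
      Z * ∏ j, expWeight (S j) (w j) (a j) := fun a => by
    rw [hZ, ← Finset.prod_mul_distrib, dotProduct, Real.exp_sum, ← Finset.prod_pow]
    refine Finset.prod_congr rfl fun j _ => ?_
    rw [expWeight, mul_div_cancel₀ _ (sum_sq_exp_pos (hS j) _).ne']
  simp_rw [hexp, mul_assoc]
  rw [← Finset.mul_sum, ← Finset.mul_sum, ← Finset.mul_sum,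
    sum_piFinset_prod_mul_dotProduct hp, sum_piFinset_prod_mul_dotProduct_sq hp,
    ← Finset.prod_univ_sum S fun j s => expWeight (S j) (w j) s]
  simp_rw [hp, Real.sq_sqrt (expVariance_nonneg (hS _) _)]
  simp only [Finset.prod_const_one, expVariance]
  ring

end ExponentialWeights

section Transfer

theorem expSysCount_comp_equiv {n : ℕ} {κ κ' : Type*} [Fintype κ] [Fintype κ'] (e : κ' ≃ κ)
    (α : κ → Fin n → ℝ) (c : Fin n → κ → ℝ) :
    expSysCount (fun a => α (e a)) (fun i a => c i (e a)) = expSysCount α c := by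
  have h0 : ∀ w : Fin n → ℝ, ∀ i, ∑ a, c i (e a) * Real.exp (α (e a) ⬝ᵥ w) =
      ∑ a, c i a * Real.exp (α a ⬝ᵥ w) := fun w i =>
    e.sum_comp fun a => c i a * Real.exp (α a ⬝ᵥ w)
  have h1 : ∀ w : Fin n → ℝ, ∀ i j, ∑ a, c i (e a) * (α (e a) j * Real.exp (α (e a) ⬝ᵥ w)) =
      ∑ a, c i a * (α a j * Real.exp (α a ⬝ᵥ w)) := fun w i j =>
    e.sum_comp fun a => c i a * (α a j * Real.exp (α a ⬝ᵥ w))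
  simp only [expSysCount, h0, h1]

theorem lintegral_expSysCount_of_fintype {n : ℕ} {κ : Type} [Fintype κ] [Nonempty κ]
    (α : κ → Fin n → ℝ) {σ : (Fin n → ℝ) → Fin n → ℝ} (hσ0 : ∀ w j, 0 ≤ σ w j)
    (hσ : ∀ w x, (∑ a, Real.exp (α a ⬝ᵥ w) ^ 2) *
        (∑ a, Real.exp (α a ⬝ᵥ w) ^ 2 * (α a ⬝ᵥ x) ^ 2) -
          (∑ a, Real.exp (α a ⬝ᵥ w) ^ 2 * (α a ⬝ᵥ x)) ^ 2 =
      (∑ a, Real.exp (α a ⬝ᵥ w) ^ 2) ^ 2 * ∑ j, σ w j ^ 2 * x j ^ 2) :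
    ∫⁻ c, expSysCount α c ∂(Measure.pi fun _ => stdGauss κ) =
      ENNReal.ofReal ((Real.pi ^ (((n : ℝ) + 1) / 2) / Real.Gamma ((n + 1) / 2))⁻¹) *
        ∫⁻ w, ENNReal.ofReal (∏ j, σ w j) := by
  obtain ⟨m, hm⟩ := Nat.exists_eq_succ_of_ne_zero (Fintype.card_ne_zero (α := κ))
  let e : Fin (m + 1) ≃ κ := (Fintype.equivFinOfCardEq hm).symm
  rw [← lintegral_expSysCount (fun a => α (e a)) hσ0 fun w x => by
    rw [e.sum_comp fun a => Real.exp (α a ⬝ᵥ w) ^ 2,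
      e.sum_comp fun a => Real.exp (α a ⬝ᵥ w) ^ 2 * (α a ⬝ᵥ x),
      e.sum_comp fun a => Real.exp (α a ⬝ᵥ w) ^ 2 * (α a ⬝ᵥ x) ^ 2]
    exact hσ w x]
  let E : (Fin n → Fin (m + 1) → ℝ) ≃ᵐ (Fin n → κ → ℝ) :=
    MeasurableEquiv.piCongrRight fun _ => MeasurableEquiv.piCongrLeft (fun _ => ℝ) e
  have hE : MeasurePreserving E (Measure.pi fun _ => stdGauss (Fin (m + 1)))
      (Measure.pi fun _ => stdGauss κ) :=
    measurePreserving_pi _ _ fun _ => measurePreserving_piCongrLeft (fun _ => gaussianReal 0 1) e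
  rw [← hE.lintegral_comp_emb E.measurableEmbedding]
  refine lintegral_congr fun c => ?_
  rw [← expSysCount_comp_equiv e]
  congr 1
  ext i a
  exact Equiv.piCongrLeft_apply_apply (fun _ => ℝ) e (c i) a

theorem encard_nondegZeros {n : ℕ} (A : Finset (EuclideanSpace ℝ (Fin n)))
    (c : Fin n → A → ℝ) :
    ((nondegZeros (fun _ => A) c).encard : ℝ≥0∞) =
      expSysCount (fun a : A => (a : EuclideanSpace ℝ (Fin n)).ofLp) c := by
  have hin : ∀ a w : EuclideanSpace ℝ (Fin n), ⟪a, w⟫ = a.ofLp ⬝ᵥ w.ofLp := fun a w => by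
    rw [EuclideanSpace.inner_eq_star_dotProduct, star_trivial, dotProduct_comm]
  have hderiv : ∀ w, HasFDerivAt (sysF (fun _ => A) c)
      (ContinuousLinearMap.pi fun i => ∑ a : A, c i a •
        Real.exp ⟪(a : EuclideanSpace ℝ (Fin n)), w⟫ • innerSL ℝ (a : EuclideanSpace ℝ (Fin n))) w := fun w => by
    rw [hasFDerivAt_pi]
    exact fun i => HasFDerivAt.fun_sum fun a _ =>
      (((innerSL ℝ (a : EuclideanSpace ℝ (Fin n))).hasFDerivAt).exp.const_mul (c i a))
  have hbij : ∀ w, Function.Bijective (fderiv ℝ (sysF (fun _ => A) c) w) ↔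
      (Matrix.of fun i j => ∑ a : A, c i a * ((a : EuclideanSpace ℝ (Fin n)).ofLp j *
        Real.exp ((a : EuclideanSpace ℝ (Fin n)).ofLp ⬝ᵥ w.ofLp))).det ≠ 0 := fun w => by
    set J : Matrix (Fin n) (Fin n) ℝ := Matrix.of fun i j =>
      ∑ a : A, c i a * ((a : EuclideanSpace ℝ (Fin n)).ofLp j *
        Real.exp ((a : EuclideanSpace ℝ (Fin n)).ofLp ⬝ᵥ w.ofLp)) with hJ
    have hcomp : (fderiv ℝ (sysF (fun _ => A) c) w : EuclideanSpace ℝ (Fin n) → Fin n → ℝ) =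
        J.mulVec ∘ WithLp.ofLp := by
      rw [(hderiv w).fderiv]
      ext v i
      simp only [ContinuousLinearMap.coe_pi', sum_apply, smul_apply,
        innerSL_apply_apply, smul_eq_mul, hin, Function.comp_apply]
      simp only [hJ, Matrix.mulVec, dotProduct, Matrix.of_apply, Finset.sum_mul, Finset.mul_sum]
      rw [Finset.sum_comm]
      exact Finset.sum_congr rfl fun a _ => Finset.sum_congr rfl fun j _ => by ring
    rw [hcomp, Function.Bijective.of_comp_iff _ (WithLp.ofLp_bijective 2), ← isUnit_iff_ne_zero,
      ← Matrix.isUnit_iff_isUnit_det]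
    exact ⟨fun h => Matrix.mulVec_injective_iff_isUnit.1 h.1, fun h =>
      ⟨Matrix.mulVec_injective_iff_isUnit.2 h, Matrix.mulVec_surjective_iff_isUnit.2 h⟩⟩
  rw [expSysCount, ← (WithLp.toLp_injective 2).encard_image {w : Fin n → ℝ | _}]
  refine congrArg (fun s : Set (EuclideanSpace ℝ (Fin n)) => (s.encard : ℝ≥0∞)) ?_
  ext w
  simp only [nondegZeros, Set.mem_ofPred_eq, Set.mem_image, hbij, funext_iff, sysF, Fexp,
    Pi.zero_apply, hin]
  exact ⟨fun h => ⟨w.ofLp, h, rfl⟩, by rintro ⟨v, h, rfl⟩; exact h⟩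

theorem encard_nondegZeros_one (S : Finset ℝ) (c : S → ℝ) :
    (({w : ℝ | (∑ s : S, c s * Real.exp ((s : ℝ) * w)) = 0 ∧
        deriv (fun w => ∑ s : S, c s * Real.exp ((s : ℝ) * w)) w ≠ 0}).encard : ℝ≥0∞) =
      expSysCount (fun (s : S) (_ : Fin 1) => (s : ℝ)) fun _ => c := by
  have hderiv : ∀ w, deriv (fun w => ∑ s : S, c s * Real.exp ((s : ℝ) * w)) w =
      ∑ s : S, c s * ((s : ℝ) * Real.exp ((s : ℝ) * w)) := fun w => by
    refine (HasDerivAt.fun_sum fun s _ => ?_).deriv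
    have := (((hasDerivAt_id w).const_mul (s : ℝ)).exp).const_mul (c s)
    simpa [mul_comm (s : ℝ)] using this
  have hinj : Function.Injective fun (t : ℝ) (_ : Fin 1) => t := fun a b h => congrFun h 0
  rw [expSysCount, ← hinj.encard_image]
  congr 2
  ext w
  simp only [Set.mem_ofPred_eq, Set.mem_image, hderiv, dotProduct, Fin.forall_fin_one,
    Finset.univ_unique, Finset.sum_singleton, Matrix.det_unique, Matrix.of_apply]
  constructor
  · rintro ⟨t, h, rfl⟩
    exact h
  · exact fun h => ⟨w 0, h, funext fun i => by rw [Subsingleton.elim i 0]⟩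

theorem E1_eq {S : Finset ℝ} (hS : S.Nonempty) :
    E1 S = ENNReal.ofReal Real.pi⁻¹ * ∫⁻ t, ENNReal.ofReal √(expVariance S t) := by
  have : Nonempty S := hS.to_subtype
  have hmp : MeasurePreserving (MeasurableEquiv.funUnique (Fin 1) (S → ℝ))
      (Measure.pi fun _ => stdGauss S) (stdGauss S) :=
    measurePreserving_funUnique (stdGauss S) (Fin 1)
  have hvar := lintegral_expSysCount_of_fintype (fun (s : S) (_ : Fin 1) => (s : ℝ))
    (σ := fun w j => √(expVariance S (w j))) (fun _ _ => Real.sqrt_nonneg _) fun w x => by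
      have hZ := sum_sq_exp_pos hS (w 0)
      set Z := ∑ s ∈ S, Real.exp (s * w 0) ^ 2
      have hexp : ∀ s, Real.exp (s * w 0) ^ 2 = Z * expWeight S (w 0) s := fun s =>
        (mul_div_cancel₀ _ hZ.ne').symm
      simp only [dotProduct, Finset.univ_unique, Finset.sum_singleton, Fin.default_eq_zero]
      rw [Finset.sum_coe_sort S fun s => Real.exp (s * w 0) ^ 2,
        Finset.sum_coe_sort S fun s => Real.exp (s * w 0) ^ 2 * (s * x 0),
        Finset.sum_coe_sort S fun s => Real.exp (s * w 0) ^ 2 * (s * x 0) ^ 2,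
        Real.sq_sqrt (expVariance_nonneg hS _), expVariance]
      simp_rw [hexp, mul_pow, mul_assoc, ← Finset.mul_sum, sum_expWeight hS, ← mul_assoc,
        ← Finset.sum_mul]
      ring
  have hprod : ∫⁻ w : Fin 1 → ℝ, ENNReal.ofReal (∏ j, √(expVariance S (w j))) =
      ∫⁻ t, ENNReal.ofReal √(expVariance S t) := by
    have h := lintegral_fin_prod_eq_prod (n := 1) (μ := fun _ => (volume : Measure ℝ))
      (f := fun _ t => ENNReal.ofReal √(expVariance S t)) fun _ =>
        ENNReal.measurable_ofReal.comp (measurable_expVariance S).sqrt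
    rw [← volume_pi] at h
    simpa using h
  rw [hprod] at hvar
  rw [E1, ← hmp.lintegral_comp_emb (MeasurableEquiv.measurableEmbedding _)]
  simp_rw [encard_nondegZeros_one]
  refine (lintegral_congr fun c => ?_).trans (hvar.trans ?_)
  · congr 1
    ext i
    rw [Subsingleton.elim i 0]
    rfl
  · norm_num

theorem EE_prodSupport_eq {n : ℕ} {S : Fin n → Finset ℝ} (hS : ∀ i, (S i).Nonempty) :
    EE (fun _ : Fin n => prodSupport S) =
      ENNReal.ofReal ((Real.pi ^ (((n : ℝ) + 1) / 2) / Real.Gamma ((n + 1) / 2))⁻¹) *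
        ∏ j, ∫⁻ t, ENNReal.ofReal √(expVariance (S j) t) := by
  have : Nonempty (prodSupport S) :=
    ((Fintype.piFinset_nonempty.2 hS).map).to_subtype
  have hsum : ∀ g : (Fin n → ℝ) → ℝ,
      ∑ a : prodSupport S, g (a : EuclideanSpace ℝ (Fin n)).ofLp =
        ∑ a ∈ Fintype.piFinset S, g a := fun g => by
    rw [Finset.sum_coe_sort (prodSupport S) fun a => g a.ofLp, prodSupport, Finset.sum_map]
    rfl
  have h := lintegral_expSysCount_of_fintype
    (fun a : prodSupport S => (a : EuclideanSpace ℝ (Fin n)).ofLp)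
    (σ := fun w j => √(expVariance (S j) (w j))) (fun _ _ => Real.sqrt_nonneg _) fun w x => by
      rw [hsum fun a => Real.exp (a ⬝ᵥ w) ^ 2,
        hsum fun a => Real.exp (a ⬝ᵥ w) ^ 2 * (a ⬝ᵥ x),
        hsum fun a => Real.exp (a ⬝ᵥ w) ^ 2 * (a ⬝ᵥ x) ^ 2]
      exact sum_piFinset_exp_variance hS w x
  have hprod : ∫⁻ w : Fin n → ℝ, ENNReal.ofReal (∏ j, √(expVariance (S j) (w j))) =
      ∏ j, ∫⁻ t, ENNReal.ofReal √(expVariance (S j) t) := by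
    have h := lintegral_fin_prod_eq_prod (μ := fun _ => (volume : Measure ℝ))
      (f := fun j t => ENNReal.ofReal √(expVariance (S j) t)) fun j =>
        ENNReal.measurable_ofReal.comp (measurable_expVariance (S j)).sqrt
    rw [← h, ← volume_pi]
    exact lintegral_congr fun w => ENNReal.ofReal_prod_of_nonneg fun _ _ => Real.sqrt_nonneg _
  rw [hprod] at h
  rw [← h, EE]
  simp_rw [encard_nondegZeros]
  rfl

end Transfer

/-- Proposition 1.2: for `A = S_1 × ⋯ × S_n`,
`E(A,…,A) = π^n · vol(ℙ^n)⁻¹ · E(S_1)⋯E(S_n)` with `vol(ℙ^n) = π^{(n+1)/2}/Γ((n+1)/2)`. -/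
theorem MVR {n : ℕ} (S : Fin n → Finset ℝ) (hS : ∀ i, (S i).Nonempty) :
    EE (fun _ : Fin n => prodSupport S) =
      ENNReal.ofReal
        (Real.pi ^ n * (Real.pi ^ (((n : ℝ) + 1) / 2) / Real.Gamma ((n + 1) / 2))⁻¹) *
        ∏ i, E1 (S i) := by
  have hpi : ENNReal.ofReal (Real.pi ^ n) * ENNReal.ofReal Real.pi⁻¹ ^ n = 1 := by
    rw [ENNReal.ofReal_pow Real.pi_pos.le, ← mul_pow, ← ENNReal.ofReal_mul Real.pi_pos.le,
      mul_inv_cancel₀ Real.pi_ne_zero, ENNReal.ofReal_one, one_pow]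
  rw [EE_prodSupport_eq hS]
  simp_rw [E1_eq (hS _)]
  rw [Finset.prod_mul_distrib, Finset.prod_const, Finset.card_univ, Fintype.card_fin,
    ENNReal.ofReal_mul (by positivity), mul_comm (ENNReal.ofReal (Real.pi ^ n)), ← mul_assoc,
    mul_assoc (ENNReal.ofReal _) (ENNReal.ofReal (Real.pi ^ n)), hpi, mul_one]

end
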